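/- For every k ≥ 1, d(a_k, b_k) = 4k², where a_k = W^{−k} V^k W^k V^{−k} and b_k = W^{−k} W^k V^k V^{−k} are words in the generators of B_3. -/

import Mathlib

namespace Braid

/-- A letter `σ_i^{±1}`: generator index `i` and sign (`true` = `σ_i`, `false` = `σ_i⁻¹`). -/
abbrev BraidLetter : Type := ℕ × Bool

/-- A word in the braid generators: a finite sequence of letters `σ_i^{±1}`. -/
abbrev BraidWord : Type := List BraidLetter

/-- `w` is a word in the generators `σ_1, …, σ_{n-1}` of `B_n`. -/
def IsWord (n : ℕ) (w : BraidWord) : Prop := ∀ l ∈ w, 1 ≤ l.1 ∧ l.1 < n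

/-- The relators of the braid group `B_n`, inside the free group on generators
indexed by `ℕ` (only the generators `σ_1, …, σ_{n-1}` are involved in relations,
so that on words in these generators the presented group is exactly `B_n`). -/
def braidRels (n : ℕ) : Set (FreeGroup ℕ) :=
  {r | ∃ i : ℕ, 1 ≤ i ∧ i + 2 ≤ n ∧
      r = FreeGroup.of i * FreeGroup.of (i+1) * FreeGroup.of i *
          (FreeGroup.of (i+1) * FreeGroup.of i * FreeGroup.of (i+1))⁻¹} ∪
  {r | ∃ i j : ℕ, 1 ≤ i ∧ 1 ≤ j ∧ i < n ∧ j < n ∧ i + 2 ≤ j ∧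
      r = FreeGroup.of i * FreeGroup.of j * (FreeGroup.of j * FreeGroup.of i)⁻¹}

/-- The braid group `B_n`, presented by the generators `σ_i` and the braid relations. -/
abbrev BraidGroup (n : ℕ) := PresentedGroup (braidRels n)

/-- The element of `B_n` represented by a single letter `σ_i^{±1}`. -/
def evalLetter (n : ℕ) (l : BraidLetter) : BraidGroup n :=
  if l.2 then PresentedGroup.of l.1 else (PresentedGroup.of l.1)⁻¹

/-- The element of `B_n` represented by a word. -/
def eval (n : ℕ) (w : BraidWord) : BraidGroup n := (w.map (evalLetter n)).prod

/-- Type (1) elementary modification: replacing a subword `σ_i σ_{i+1} σ_i` by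
`σ_{i+1} σ_i σ_{i+1}` or vice versa, `1 ≤ i ≤ n - 2`. -/
inductive Move1 (n : ℕ) : BraidWord → BraidWord → Prop
  | fwd (u v : BraidWord) (i : ℕ) (h1 : 1 ≤ i) (h2 : i + 2 ≤ n) :
      Move1 n (u ++ [(i, true), (i+1, true), (i, true)] ++ v)
              (u ++ [(i+1, true), (i, true), (i+1, true)] ++ v)
  | bwd (u v : BraidWord) (i : ℕ) (h1 : 1 ≤ i) (h2 : i + 2 ≤ n) :
      Move1 n (u ++ [(i+1, true), (i, true), (i+1, true)] ++ v)
              (u ++ [(i, true), (i+1, true), (i, true)] ++ v)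

/-- Type (2) elementary modification: replacing a subword `σ_i σ_j` by `σ_j σ_i`
for `|i - j| ≥ 2` (in either direction, as `i` and `j` are symmetric). -/
inductive Move2 (n : ℕ) : BraidWord → BraidWord → Prop
  | swap (u v : BraidWord) (i j : ℕ) (h1 : 1 ≤ i) (h2 : 1 ≤ j)
      (h3 : i < n) (h4 : j < n) (h5 : i + 2 ≤ j ∨ j + 2 ≤ i) :
      Move2 n (u ++ [(i, true), (j, true)] ++ v)
              (u ++ [(j, true), (i, true)] ++ v)

/-- Type (3) elementary modification: deleting or inserting a subword
`σ_i σ_i⁻¹` or `σ_i⁻¹ σ_i`. -/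
inductive Move3 (n : ℕ) : BraidWord → BraidWord → Prop
  | del (u v : BraidWord) (i : ℕ) (b : Bool) (h1 : 1 ≤ i) (h2 : i < n) :
      Move3 n (u ++ [(i, b), (i, !b)] ++ v) (u ++ v)
  | ins (u v : BraidWord) (i : ℕ) (b : Bool) (h1 : 1 ≤ i) (h2 : i < n) :
      Move3 n (u ++ v) (u ++ [(i, b), (i, !b)] ++ v)

/-- `Reach n c a b`: there is a finite sequence of elementary modifications in `B_n`
transforming `a` into `b` and containing exactly `c` modifications of type (1). -/
inductive Reach (n : ℕ) : ℕ → BraidWord → BraidWord → Prop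
  | refl (a : BraidWord) : Reach n 0 a a
  | step1 {a b c : BraidWord} {k : ℕ} : Move1 n a b → Reach n k b c → Reach n (k+1) a c
  | step2 {a b c : BraidWord} {k : ℕ} : Move2 n a b → Reach n k b c → Reach n k a c
  | step3 {a b c : BraidWord} {k : ℕ} : Move3 n a b → Reach n k b c → Reach n k a c

/-- The distance `d(a,b)`: the minimal number of type (1) modifications among all
finite sequences of elementary modifications transforming `a` into `b`. -/
noncomputable def braidDist (n : ℕ) (a b : BraidWord) : ℕ := sInf {c | Reach n c a b}


/-- The `k`-fold concatenation `w^k` of a word. -/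
def wpow (w : BraidWord) (k : ℕ) : BraidWord := (List.replicate k w).flatten

/-- The formal inverse `w⁻¹` of a word: letters inverted and order reversed. -/
def winv (w : BraidWord) : BraidWord := w.reverse.map (fun l => (l.1, !l.2))

/-- The word `V = σ_1²`. -/
def V : BraidWord := [(1, true), (1, true)]

/-- The word `W = σ_2 σ_1² σ_2`. -/
def W : BraidWord := [(2, true), (1, true), (1, true), (2, true)]

/-- The word `a_k = W^{-k} V^k W^k V^{-k}`. -/
def ak (k : ℕ) : BraidWord := winv (wpow W k) ++ wpow V k ++ wpow W k ++ winv (wpow V k)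

/-- The word `b_k = W^{-k} W^k V^k V^{-k}`. -/
def bk (k : ℕ) : BraidWord := winv (wpow W k) ++ wpow W k ++ wpow V k ++ winv (wpow V k)


/-! ### Upper bound -/

theorem Move1.context {n : ℕ} {a b : BraidWord} (x y : BraidWord) (h : Move1 n a b) :
    Move1 n (x ++ a ++ y) (x ++ b ++ y) := by
  cases h with
  | fwd u v i h1 h2 => simpa using Move1.fwd (n := n) (x ++ u) (v ++ y) i h1 h2
  | bwd u v i h1 h2 => simpa using Move1.bwd (n := n) (x ++ u) (v ++ y) i h1 h2

theorem Move2.context {n : ℕ} {a b : BraidWord} (x y : BraidWord) (h : Move2 n a b) :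
    Move2 n (x ++ a ++ y) (x ++ b ++ y) := by
  cases h with
  | swap u v i j h1 h2 h3 h4 h5 =>
    simpa using Move2.swap (n := n) (x ++ u) (v ++ y) i j h1 h2 h3 h4 h5

theorem Move3.context {n : ℕ} {a b : BraidWord} (x y : BraidWord) (h : Move3 n a b) :
    Move3 n (x ++ a ++ y) (x ++ b ++ y) := by
  cases h with
  | del u v i b h1 h2 => simpa using Move3.del (n := n) (x ++ u) (v ++ y) i b h1 h2
  | ins u v i b h1 h2 => simpa using Move3.ins (n := n) (x ++ u) (v ++ y) i b h1 h2

theorem Reach.context {n c : ℕ} {a b : BraidWord} (x y : BraidWord) (h : Reach n c a b) :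
    Reach n c (x ++ a ++ y) (x ++ b ++ y) := by
  induction h with
  | refl a => exact .refl _
  | step1 m _ ih => exact .step1 (m.context x y) ih
  | step2 m _ ih => exact .step2 (m.context x y) ih
  | step3 m _ ih => exact .step3 (m.context x y) ih

theorem Reach.trans {n c d : ℕ} {x y z : BraidWord} (h : Reach n c x y) (h' : Reach n d y z) :
    Reach n (c + d) x z := by
  induction h with
  | refl a => simpa using h'
  | step1 m _ ih => simpa only [Nat.add_right_comm] using Reach.step1 m (ih h')
  | step2 m _ ih => exact .step2 m (ih h')
  | step3 m _ ih => exact .step3 m (ih h')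

theorem wpow_succ (w : BraidWord) (k : ℕ) : wpow w (k + 1) = w ++ wpow w k := by
  simp [wpow, List.replicate_succ]

theorem reach_comm_wpow {n c : ℕ} {x y : BraidWord} (h : Reach n c (x ++ y) (y ++ x)) (k : ℕ) :
    Reach n (c * k) (x ++ wpow y k) (wpow y k ++ x) := by
  induction k with
  | zero => simpa [wpow] using Reach.refl (n := n) x
  | succ k ih =>
    have h1 := h.context [] (wpow y k)
    have h2 := ih.context y []
    rw [wpow_succ, Nat.mul_succ, Nat.add_comm]
    exact Reach.trans (by simpa using h1) (by simpa using h2)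

theorem reach_wpow_comm {n c : ℕ} {x y : BraidWord} (h : Reach n c (x ++ y) (y ++ x)) (k : ℕ) :
    Reach n (c * k) (wpow x k ++ y) (y ++ wpow x k) := by
  induction k with
  | zero => simpa [wpow] using Reach.refl (n := n) y
  | succ k ih =>
    have h1 := ih.context x []
    have h2 := h.context [] (wpow x k)
    rw [wpow_succ, Nat.mul_succ]
    exact Reach.trans (by simpa using h1) (by simpa using h2)

theorem reach_V_W : Reach 3 4 (V ++ W) (W ++ V) := by
  refine .step1 (.fwd [(1, true)] [(1, true), (2, true)] 1 le_rfl le_rfl) ?_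
  refine .step1 (.bwd [(1, true), (2, true), (1, true)] [] 1 le_rfl le_rfl) ?_
  refine .step1 (.fwd [] [(1, true), (2, true), (1, true)] 1 le_rfl le_rfl) ?_
  refine .step1 (.bwd [(2, true), (1, true)] [(1, true)] 1 le_rfl le_rfl) ?_
  exact .refl _

theorem reach_ak_bk (k : ℕ) : Reach 3 (4 * k ^ 2) (ak k) (bk k) := by
  have h := (reach_comm_wpow (reach_wpow_comm reach_V_W k) k).context
    (winv (wpow W k)) (winv (wpow V k))
  have e : 4 * k * k = 4 * k ^ 2 := by ring
  simpa [ak, bk, e] using h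

/-! ### Lower bound

Words act on the right on triples `(p, q, e)`: the row vector `(p, q)` is acted upon by `SL₂(ℤ)`,
and `e` records the exponent sum. Each positive letter rotates `(p, q)` counterclockwise; the weight
of a word is the sum of `e` over all the times the vector enters a new quadrant. It is unchanged by
free reductions, and changes by at most one under a braid relation. -/

/-- The effect of a letter on a triple `(p, q, e)`. -/
def next : BraidLetter → ℤ × ℤ × ℤ → ℤ × ℤ × ℤ
  | (i, true), (p, q, e) => if i = 1 then (p, p + q, e + 1) else (p - q, q, e + 1)
  | (i, false), (p, q, e) => if i = 1 then (p, q - p, e - 1) else (p + q, q, e - 1)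

/-- The weight of the positive letter `σ_i` starting at a triple `(p, q, e)`. -/
def posCost (i : ℕ) : ℤ × ℤ × ℤ → ℤ
  | (p, q, e) =>
    if i = 1 then
      if (p < 0 ∧ 0 < q ∧ p + q ≤ 0) ∨ (0 < p ∧ q < 0 ∧ 0 ≤ p + q) then e else 0
    else if (0 < q ∧ 0 < p ∧ p - q ≤ 0) ∨ (q < 0 ∧ p < 0 ∧ 0 ≤ p - q) then e else 0

/-- The weight of a letter starting at a given triple. -/
def cost : BraidLetter → ℤ × ℤ × ℤ → ℤ
  | (i, true), s => posCost i s
  | (i, false), s => -posCost i (next (i, false) s)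

/-- The effect of a word on a triple. -/
def final (w : BraidWord) (s : ℤ × ℤ × ℤ) : ℤ × ℤ × ℤ := w.foldl (fun s l => next l s) s

/-- The weight of a word starting at a given triple. -/
def weight : BraidWord → ℤ × ℤ × ℤ → ℤ
  | [], _ => 0
  | l :: w, s => cost l s + weight w (next l s)

theorem final_append (u v : BraidWord) (s : ℤ × ℤ × ℤ) :
    final (u ++ v) s = final v (final u s) := by
  simp [final]

theorem weight_append (u v : BraidWord) (s : ℤ × ℤ × ℤ) :
    weight (u ++ v) s = weight u s + weight v (final u s) := by
  induction u generalizing s with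
  | nil => simp [weight, final]
  | cons l u ih => simp [weight, final, ih, add_assoc]

theorem next_next_inv (i : ℕ) (b : Bool) (s : ℤ × ℤ × ℤ) :
    next (i, !b) (next (i, b) s) = s := by
  obtain ⟨p, q, e⟩ := s
  cases b <;> by_cases h : i = 1 <;> simp [next, h]

theorem cost_inv (i : ℕ) (b : Bool) (s : ℤ × ℤ × ℤ) :
    cost (i, !b) (next (i, b) s) = -cost (i, b) s := by
  cases b
  · simp [cost]
  · have := next_next_inv i true s
    simp_all [cost]

theorem winv_cons (l : BraidLetter) (w : BraidWord) : winv (l :: w) = winv w ++ [(l.1, !l.2)] := by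
  simp [winv]

theorem final_winv (w : BraidWord) (s : ℤ × ℤ × ℤ) : final (winv w) (final w s) = s := by
  induction w generalizing s with
  | nil => rfl
  | cons l w ih =>
    have h := ih (next l s)
    rw [winv_cons, final_append]
    simp only [final, List.foldl_cons, List.foldl_nil] at h ⊢
    rw [h, next_next_inv]

theorem weight_winv (w : BraidWord) (s : ℤ × ℤ × ℤ) :
    weight (winv w) (final w s) = -weight w s := by
  induction w generalizing s with
  | nil => rfl
  | cons l w ih =>
    have e : final (l :: w) s = final w (next l s) := rfl
    rw [winv_cons, weight_append, e, ih, final_winv]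
    change -weight w (next l s) + (cost (l.1, !l.2) (next (l.1, l.2) s) + 0) = -(cost l s + _)
    rw [cost_inv]
    ring

theorem final_braid (s : ℤ × ℤ × ℤ) :
    final [(1, true), (2, true), (1, true)] s = final [(2, true), (1, true), (2, true)] s := by
  obtain ⟨p, q, e⟩ := s
  simp [final, next]

theorem weight_braid (s : ℤ × ℤ × ℤ) :
    |weight [(2, true), (1, true), (2, true)] s - weight [(1, true), (2, true), (1, true)] s| ≤ 1 := by
  obtain ⟨p, q, e⟩ := s
  simp only [weight, cost, posCost, next, if_true, OfNat.ofNat_ne_one, if_false]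
  rw [abs_le]
  rcases lt_trichotomy p 0 with hp | rfl | hp <;> rcases lt_trichotomy q 0 with hq | rfl | hq <;>
    grind

theorem abs_weight_sub_le_of_move1 {a b : BraidWord} (h : Move1 3 a b) (s : ℤ × ℤ × ℤ) :
    |weight b s - weight a s| ≤ 1 := by
  cases h with
  | fwd u v i h1 h2 =>
    obtain rfl : i = 1 := by omega
    simp only [weight_append, final_append, Nat.reduceAdd, final_braid, add_sub_add_left_eq_sub,
      add_sub_add_right_eq_sub]
    exact weight_braid (final u s)
  | bwd u v i h1 h2 =>
    obtain rfl : i = 1 := by omega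
    rw [abs_sub_comm]
    simp only [weight_append, final_append, Nat.reduceAdd, final_braid, add_sub_add_left_eq_sub,
      add_sub_add_right_eq_sub]
    exact weight_braid (final u s)

theorem weight_cancel (u v : BraidWord) (i : ℕ) (b : Bool) (s : ℤ × ℤ × ℤ) :
    weight (u ++ [(i, b), (i, !b)] ++ v) s = weight (u ++ v) s := by
  simp [weight_append, weight, final, next_next_inv, cost_inv]

theorem weight_eq_of_move3 {n : ℕ} {a b : BraidWord} (h : Move3 n a b) (s : ℤ × ℤ × ℤ) :
    weight b s = weight a s := by
  cases h with
  | del u v i b => exact (weight_cancel u v i b s).symm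
  | ins u v i b => exact weight_cancel u v i b s

theorem abs_weight_sub_le_of_reach {c : ℕ} {a b : BraidWord} (h : Reach 3 c a b) (s : ℤ × ℤ × ℤ) :
    |weight b s - weight a s| ≤ c := by
  induction h with
  | refl a => simp
  | step1 m _ ih =>
    push_cast
    linarith [abs_sub_le _ _ _ |>.trans (add_le_add ih (abs_weight_sub_le_of_move1 m s))]
  | step2 m _ ih =>
    cases m
    omega
  | step3 m _ ih => rwa [weight_eq_of_move3 m s] at ih

theorem weight_eq_zero (w : BraidWord) (hw : ∀ l ∈ w, l.1 = 1) (q e : ℤ) :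
    weight w (0, q, e) = 0 := by
  induction w generalizing e with
  | nil => rfl
  | cons l w ih =>
    obtain ⟨i, b⟩ := l
    obtain rfl : i = 1 := hw (i, b) (by simp)
    have hw' : ∀ l ∈ w, l.1 = 1 := fun l hl => hw l (by simp [hl])
    cases b <;> simp [weight, cost, posCost, next, ih hw']

theorem fst_eq_one_of_mem_wpow_V {k : ℕ} {l : BraidLetter} (h : l ∈ wpow V k) : l.1 = 1 := by
  simp only [wpow, List.mem_flatten, List.mem_replicate] at h
  obtain ⟨_, ⟨_, rfl⟩, h⟩ := h
  simp only [V, List.mem_cons, List.not_mem_nil, or_false, or_self] at h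
  rw [h]

theorem weight_wpow_V (k : ℕ) (q e : ℤ) : weight (wpow V k) (0, q, e) = 0 :=
  weight_eq_zero _ (fun _ => fst_eq_one_of_mem_wpow_V) q e

theorem weight_winv_wpow_V (k : ℕ) (q e : ℤ) : weight (winv (wpow V k)) (0, q, e) = 0 := by
  refine weight_eq_zero _ (fun l hl => ?_) q e
  simp only [winv, List.mem_map, List.mem_reverse] at hl
  obtain ⟨l', hl', rfl⟩ := hl
  exact fst_eq_one_of_mem_wpow_V (l := l') hl'

theorem final_wpow_V (k : ℕ) (q e : ℤ) : final (wpow V k) (0, q, e) = (0, q, e + 2 * k) := by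
  induction k generalizing e with
  | zero => simp [wpow, final]
  | succ k ih =>
    have h : final V (0, q, e) = (0, q, e + 2) := by simp [final, V, next, add_assoc]
    rw [wpow_succ, final_append, h, ih]
    push_cast
    ring_nf

theorem final_W (q e : ℤ) : final W (0, q, e) = (0, -q, e + 4) := by
  simp [final, W, next, add_assoc]

theorem weight_W {q : ℤ} (hq : q ≠ 0) (e : ℤ) : weight W (0, q, e) = 2 * e + 4 := by
  simp only [W, weight, cost, posCost, next, if_true, OfNat.ofNat_ne_one, if_false]
  split_ifs <;> omega

theorem final_wpow_W (k : ℕ) (q e : ℤ) :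
    final (wpow W k) (0, q, e) = (0, (-1) ^ k * q, e + 4 * k) := by
  induction k generalizing q e with
  | zero => simp [wpow, final]
  | succ k ih =>
    rw [wpow_succ, final_append, final_W, ih]
    push_cast
    ring_nf

theorem weight_wpow_W (k : ℕ) {q : ℤ} (hq : q ≠ 0) (e : ℤ) :
    weight (wpow W k) (0, q, e) = 2 * k * e + 4 * k ^ 2 := by
  induction k generalizing q e with
  | zero => simp [wpow, weight]
  | succ k ih =>
    rw [wpow_succ, weight_append, final_W, weight_W hq, ih (neg_ne_zero.2 hq)]
    push_cast
    ring

theorem weight_ak (k : ℕ) : weight (ak k) (final (wpow W k) (0, 1, 0)) = 4 * k ^ 2 := by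
  simp only [ak, weight_append, final_append]
  rw [weight_winv, final_winv, final_wpow_V, weight_wpow_V, weight_wpow_W _ one_ne_zero,
    weight_wpow_W _ one_ne_zero, final_wpow_W, weight_winv_wpow_V]
  ring

theorem weight_bk (k : ℕ) : weight (bk k) (final (wpow W k) (0, 1, 0)) = 0 := by
  simp only [bk, weight_append, final_append]
  rw [weight_winv, final_winv, final_wpow_W, final_wpow_V, weight_wpow_V, weight_winv_wpow_V]
  ring

theorem le_of_reach_ak_bk {k c : ℕ} (h : Reach 3 c (ak k) (bk k)) : 4 * k ^ 2 ≤ c := by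
  have hle := abs_weight_sub_le_of_reach h (final (wpow W k) (0, 1, 0))
  rw [weight_ak, weight_bk, zero_sub, abs_neg] at hle
  exact_mod_cast (le_abs_self _).trans hle

/-- For every `k ≥ 1`, `d(a_k, b_k) = 4k²`. -/
theorem statement_9 (k : ℕ) (hk : 1 ≤ k) :
    braidDist 3 (ak k) (bk k) = 4 * k ^ 2 := by
  have h := reach_ak_bk k
  exact le_antisymm (Nat.sInf_le h) (le_csInf ⟨_, h⟩ fun _ => le_of_reach_ak_bk)

end Braid
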